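/- Let ℓ ≥ 1 and m ≥ 1 be integers and let θ_{α,k} ∈ ℕ for 1 ≤ α ≤ ℓ, 1 ≤ k ≤ m; set λ^{(k)}_α := Σ_{j=1}^{k} θ_{α,j}. The rational function in ζ over ℚ(q,t) given by ζ ↦ ∏_{k=1}^{m} ∏_{1≤α<β≤ℓ} ∏_{i=1}^{θ_{α,k}} ∏_{j=1}^{λ^{(k−1)}_β} γ₋( q^{-i-λ^{(k−1)}_α} ζ^{α}, q^{-j} ζ^{β}; q,t ) is regular at ζ = t, and its value at ζ = t equals ∏_{k=1}^{m} ∏_{1≤α<β≤ℓ} [ (q^{λ^{(k−1)}_α + 1} t^{β−α}; q)_{θ_{α,k}} · (q^{λ^{(k−1)}_α − λ^{(k−1)}_β} t^{β−α+1}; q)_{θ_{α,k}} ] / [ (q^{λ^{(k−1)}_α − λ^{(k−1)}_β + 1} t^{β−α}; q)_{θ_{α,k}} · (q^{λ^{(k−1)}_α} t^{β−α+1}; q)_{θ_{α,k}} ]. -/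

import Mathlib

noncomputable section

/-- The field ℚ(q,t) of rational functions in two independent indeterminates over ℚ. -/
abbrev K : Type := FractionRing (MvPolynomial (Fin 2) ℚ)

def q : K := algebraMap (MvPolynomial (Fin 2) ℚ) K (MvPolynomial.X 0)
def t : K := algebraMap (MvPolynomial (Fin 2) ℚ) K (MvPolynomial.X 1)

/-- The field ℚ(q,t)(ζ) of rational functions in ζ over ℚ(q,t). -/
abbrev R : Type := RatFunc K

/-- `q` as an element of ℚ(q,t)(ζ). -/
def Qv : R := RatFunc.C q
/-- `t` as an element of ℚ(q,t)(ζ). -/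
def Tv : R := RatFunc.C t
/-- the variable ζ. -/
def Zv : R := RatFunc.X

/-- The q-Pochhammer symbol `(u;q)_n = ∏_{i=0}^{n-1} (1 - qⁱ u)`. -/
def qPoch (q u : K) (n : ℕ) : K := ∏ i ∈ Finset.range n, (1 - q ^ i * u)

/-- `γ₋(z,w;q,t) = (z - qw)(z - q⁻¹ t w)/((z - w)(z - t w))`. -/
def gammaMinus {F : Type*} [Field F] (q t zz ww : F) : F :=
  (zz - q * ww) * (zz - q⁻¹ * t * ww) / ((zz - ww) * (zz - t * ww))

/-- The partial sums `λ^{(k)}_α = Σ_{j=1}^{k} θ_{α,j}`. -/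
def pl (θ : ℕ → ℕ → ℕ) (α k : ℕ) : ℕ := ∑ j ∈ Finset.Icc 1 k, θ α j

open Finset

/-- `f` is regular at `ζ = t` and takes the value `v` there. -/
def HasValueAt (f : R) (v : K) : Prop :=
  Polynomial.eval t f.denom ≠ 0 ∧ RatFunc.eval (RingHom.id K) t f = v

namespace HasValueAt

theorem of_polynomial (p : Polynomial K) :
    HasValueAt (algebraMap (Polynomial K) R p) (p.eval t) := by
  refine ⟨by simp, ?_⟩
  rw [RatFunc.eval_algebraMap]
  simp

theorem mul {f g : R} {u v : K} (hf : HasValueAt f u) (hg : HasValueAt g v) :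
    HasValueAt (f * g) (u * v) := by
  refine ⟨fun h => ?_, ?_⟩
  · have h0 := Polynomial.eval_eq_zero_of_dvd_of_eval_eq_zero (RatFunc.denom_mul_dvd f g) h
    rw [Polynomial.eval_mul] at h0
    exact mul_ne_zero hf.1 hg.1 h0
  · rw [RatFunc.eval_mul _ _ (by simpa [Polynomial.eval₂_id] using hf.1)
      (by simpa [Polynomial.eval₂_id] using hg.1), hf.2, hg.2]

theorem prod {ι : Type*} (s : Finset ι) {f : ι → R} {v : ι → K}
    (h : ∀ i ∈ s, HasValueAt (f i) (v i)) : HasValueAt (∏ i ∈ s, f i) (∏ i ∈ s, v i) := by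
  classical
  induction s using Finset.induction_on with
  | empty => simpa using of_polynomial 1
  | insert a s ha ih =>
    rw [prod_insert ha, prod_insert ha]
    exact (h a (mem_insert_self a s)).mul (ih fun i hi => h i (mem_insert_of_mem hi))

theorem div_of_polynomial (p s : Polynomial K) (hs : s.eval t ≠ 0) :
    HasValueAt (algebraMap (Polynomial K) R p / algebraMap (Polynomial K) R s)
      (p.eval t / s.eval t) := by
  have hs0 : s ≠ 0 := by
    rintro rfl
    simp at hs
  have hd : Polynomial.eval t
      (algebraMap (Polynomial K) R p / algebraMap (Polynomial K) R s).denom ≠ 0 := fun h =>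
    hs (Polynomial.eval_eq_zero_of_dvd_of_eval_eq_zero (RatFunc.denom_div_dvd p s) h)
  refine ⟨hd, ?_⟩
  have hm := (mul ⟨hd, rfl⟩ (of_polynomial s)).2
  rw [div_mul_cancel₀ _ (RatFunc.algebraMap_ne_zero hs0), (of_polynomial p).2] at hm
  rw [eq_div_iff hs, hm]

end HasValueAt

theorem q_ne_zero : q ≠ 0 := by
  simp [q]

theorem t_ne_zero : t ≠ 0 := by
  simp [t]

theorem q_pow_mul_t_pow_ne_q_pow (a b : ℕ) {d : ℕ} (hd : d ≠ 0) : q ^ a * t ^ d ≠ q ^ b := by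
  intro h
  simp only [q, t, ← map_pow, ← map_mul] at h
  have h' := IsFractionRing.injective (MvPolynomial (Fin 2) ℚ) K h
  have h'' := congrArg (MvPolynomial.eval ![(1 : ℚ), 0]) h'
  simp [hd] at h''

theorem one_sub_q_zpow_mul_t_zpow_ne_zero (n : ℤ) {d : ℤ} (hd : 0 < d) :
    1 - q ^ n * t ^ d ≠ 0 := by
  lift d to ℕ using hd.le
  have hd' : d ≠ 0 := by omega
  intro h
  have h1 : q ^ n * t ^ d = 1 := by
    rw [sub_eq_zero, zpow_natCast] at h
    exact h.symm
  obtain ⟨k, rfl | rfl⟩ := n.eq_nat_or_neg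
  · exact q_pow_mul_t_pow_ne_q_pow k 0 hd' (by simpa using h1)
  · refine q_pow_mul_t_pow_ne_q_pow 0 k hd' ?_
    rw [zpow_neg, zpow_natCast, inv_mul_eq_one₀ (pow_ne_zero _ q_ne_zero)] at h1
    simpa using h1.symm

theorem gammaMinus_eq_of_eq_mul {F : Type*} [Field F] (q t : F) {z w x : F} (hz : z ≠ 0)
    (hw : w = z * x) :
    gammaMinus q t z w = (1 - q * x) * (1 - q⁻¹ * t * x) / ((1 - x) * (1 - t * x)) := by
  rw [gammaMinus, hw,
    ← mul_div_mul_left ((1 - q * x) * (1 - q⁻¹ * t * x)) _ (mul_ne_zero hz hz)]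
  congr 1 <;> ring

theorem inv_pow_mul_pow_eq (n j α β : ℕ) :
    q⁻¹ ^ j * t ^ β = q⁻¹ ^ n * t ^ α * (q ^ ((n : ℤ) - j) * t ^ ((β : ℤ) - α)) := by
  have hq := q_ne_zero
  have ht := t_ne_zero
  rw [zpow_sub₀ hq, zpow_sub₀ ht]
  simp only [zpow_natCast, inv_pow]
  field_simp

theorem gammaMinus_inv_pow (n j α β : ℕ) :
    gammaMinus q t (q⁻¹ ^ n * t ^ α) (q⁻¹ ^ j * t ^ β) =
      (1 - q ^ ((n : ℤ) - j + 1) * t ^ ((β : ℤ) - α)) *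
          (1 - q ^ ((n : ℤ) - j - 1) * t ^ ((β : ℤ) - α + 1)) /
        ((1 - q ^ ((n : ℤ) - j) * t ^ ((β : ℤ) - α)) *
          (1 - q ^ ((n : ℤ) - j) * t ^ ((β : ℤ) - α + 1))) := by
  have hq := q_ne_zero
  have ht := t_ne_zero
  rw [gammaMinus_eq_of_eq_mul q t
    (mul_ne_zero (pow_ne_zero _ (inv_ne_zero hq)) (pow_ne_zero _ ht)) (inv_pow_mul_pow_eq n j α β),
    zpow_add_one₀ hq, zpow_sub_one₀ hq, zpow_add_one₀ ht]
  congr 2 <;> ring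

theorem hasValueAt_gammaMinus (n j : ℕ) {α β : ℕ} (h : α < β) :
    HasValueAt (gammaMinus Qv Tv (Qv⁻¹ ^ n * Zv ^ α) (Qv⁻¹ ^ j * Zv ^ β))
      (gammaMinus q t (q⁻¹ ^ n * t ^ α) (q⁻¹ ^ j * t ^ β)) := by
  have hz : q⁻¹ ^ n * t ^ α ≠ 0 :=
    mul_ne_zero (pow_ne_zero _ (inv_ne_zero q_ne_zero)) (pow_ne_zero _ t_ne_zero)
  have hQ : Qv⁻¹ = RatFunc.C q⁻¹ := by rw [Qv, map_inv₀]
  set z : Polynomial K := Polynomial.C q⁻¹ ^ n * Polynomial.X ^ α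
  set w : Polynomial K := Polynomial.C q⁻¹ ^ j * Polynomial.X ^ β
  have key := HasValueAt.div_of_polynomial
    ((z - Polynomial.C q * w) * (z - Polynomial.C q⁻¹ * Polynomial.C t * w))
    ((z - w) * (z - Polynomial.C t * w)) (by
      have hd : (0 : ℤ) < (β : ℤ) - α := by omega
      have h1 := one_sub_q_zpow_mul_t_zpow_ne_zero ((n : ℤ) - j) hd
      have h2 := one_sub_q_zpow_mul_t_zpow_ne_zero ((n : ℤ) - j) (add_pos hd one_pos)
      rw [zpow_add_one₀ t_ne_zero] at h2
      simp only [z, w, Polynomial.eval_mul, Polynomial.eval_sub, Polynomial.eval_pow,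
        Polynomial.eval_C, Polynomial.eval_X, inv_pow_mul_pow_eq n j α β]
      convert mul_ne_zero (mul_ne_zero hz h1) (mul_ne_zero hz h2) using 1
      ring)
  simp only [z, w, map_mul, map_sub, map_pow, RatFunc.algebraMap_C, RatFunc.algebraMap_X,
    Polynomial.eval_mul, Polynomial.eval_sub, Polynomial.eval_pow, Polynomial.eval_C,
    Polynomial.eval_X] at key
  rw [gammaMinus, hQ]
  exact key

theorem prod_gammaMinus (n b : ℕ) {α β : ℕ} (h : α < β) :
    ∏ j ∈ Icc 1 b, gammaMinus q t (q⁻¹ ^ n * t ^ α) (q⁻¹ ^ j * t ^ β) =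
      (1 - q ^ (n : ℤ) * t ^ ((β : ℤ) - α)) *
          (1 - q ^ ((n : ℤ) - b - 1) * t ^ ((β : ℤ) - α + 1)) /
        ((1 - q ^ ((n : ℤ) - b) * t ^ ((β : ℤ) - α)) *
          (1 - q ^ ((n : ℤ) - 1) * t ^ ((β : ℤ) - α + 1))) := by
  have hd : (0 : ℤ) < (β : ℤ) - α := by omega
  have h1 := fun c => one_sub_q_zpow_mul_t_zpow_ne_zero c hd
  have h2 := fun c => one_sub_q_zpow_mul_t_zpow_ne_zero c (add_pos hd one_pos)
  induction b with
  | zero =>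
    have e1 := h1 n
    have e2 := h2 (n - 1)
    simp only [Nat.cast_zero, sub_zero]
    rw [div_self (mul_ne_zero e1 e2)]
    simp
  | succ b ih =>
    rw [prod_Icc_succ_top (by omega), ih, gammaMinus_inv_pow]
    have c1 : (n : ℤ) - (b + 1 : ℕ) + 1 = n - b := by push_cast; ring
    have c2 : (n : ℤ) - (b + 1 : ℕ) = n - b - 1 := by push_cast; ring
    rw [c1, c2]
    rw [div_mul_div_comm, div_eq_div_iff
      (mul_ne_zero (mul_ne_zero (h1 _) (h2 _)) (mul_ne_zero (h1 _) (h2 _)))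
      (mul_ne_zero (h1 _) (h2 _))]
    ring

theorem qPoch_q_zpow_mul (c : ℤ) (x : K) (n : ℕ) :
    qPoch q (q ^ c * x) n = ∏ i ∈ range n, (1 - q ^ (c + i) * x) := by
  refine prod_congr rfl fun i _ => ?_
  rw [zpow_add₀ q_ne_zero, zpow_natCast]
  ring

theorem prod_prod_gammaMinus (a b n : ℕ) {α β : ℕ} (h : α < β) :
    ∏ i ∈ Icc 1 n, ∏ j ∈ Icc 1 b,
        gammaMinus q t (q⁻¹ ^ (i + a) * t ^ α) (q⁻¹ ^ j * t ^ β) =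
      (qPoch q (q ^ ((a : ℤ) + 1) * t ^ ((β : ℤ) - α)) n *
          qPoch q (q ^ ((a : ℤ) - (b : ℤ)) * t ^ ((β : ℤ) - α + 1)) n) /
        (qPoch q (q ^ ((a : ℤ) - (b : ℤ) + 1) * t ^ ((β : ℤ) - α)) n *
          qPoch q (q ^ (a : ℤ) * t ^ ((β : ℤ) - α + 1)) n) := by
  simp only [qPoch_q_zpow_mul, ← prod_mul_distrib, ← prod_div_distrib]
  rw [← Finset.Ico_add_one_right_eq_Icc, prod_Ico_eq_prod_range, Nat.add_sub_cancel]
  refine prod_congr rfl fun i _ => ?_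
  rw [prod_gammaMinus _ _ h]
  congr 3 <;> congr 3 <;> push_cast <;> ring

/-- as a rational function of ζ,
`∏_{k=1}^m ∏_{1≤α<β≤ℓ} ∏_{i=1}^{θ_{α,k}} ∏_{j=1}^{λ^{(k-1)}_β}
  γ₋(q^{-i-λ^{(k-1)}_α} ζ^α, q^{-j} ζ^β; q,t)`
is regular at ζ = t and its value there is the displayed q-Pochhammer product. -/
theorem stmt10 (l m : ℕ) (hl : 1 ≤ l) (hm : 1 ≤ m) (θ : ℕ → ℕ → ℕ) :
    Polynomial.eval t
        (∏ k ∈ Finset.Icc 1 m, ∏ α ∈ Finset.Icc 1 l, ∏ β ∈ Finset.Ioc α l,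
          ∏ i ∈ Finset.Icc 1 (θ α k), ∏ j ∈ Finset.Icc 1 (pl θ β (k - 1)),
            gammaMinus Qv Tv (Qv⁻¹ ^ (i + pl θ α (k - 1)) * Zv ^ α)
              (Qv⁻¹ ^ j * Zv ^ β)).denom ≠ 0
    ∧ RatFunc.eval (RingHom.id K) t
        (∏ k ∈ Finset.Icc 1 m, ∏ α ∈ Finset.Icc 1 l, ∏ β ∈ Finset.Ioc α l,
          ∏ i ∈ Finset.Icc 1 (θ α k), ∏ j ∈ Finset.Icc 1 (pl θ β (k - 1)),
            gammaMinus Qv Tv (Qv⁻¹ ^ (i + pl θ α (k - 1)) * Zv ^ α)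
              (Qv⁻¹ ^ j * Zv ^ β))
      = ∏ k ∈ Finset.Icc 1 m, ∏ α ∈ Finset.Icc 1 l, ∏ β ∈ Finset.Ioc α l,
          (qPoch q (q ^ ((pl θ α (k - 1) : ℤ) + 1) * t ^ ((β : ℤ) - α)) (θ α k) *
              qPoch q (q ^ ((pl θ α (k - 1) : ℤ) - (pl θ β (k - 1) : ℤ)) *
                t ^ ((β : ℤ) - α + 1)) (θ α k)) /
            (qPoch q (q ^ ((pl θ α (k - 1) : ℤ) - (pl θ β (k - 1) : ℤ) + 1) *
                t ^ ((β : ℤ) - α)) (θ α k) *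
              qPoch q (q ^ (pl θ α (k - 1) : ℤ) * t ^ ((β : ℤ) - α + 1)) (θ α k)) := by
  refine HasValueAt.prod _ fun k _ => HasValueAt.prod _ fun α _ => HasValueAt.prod _ fun β hβ => ?_
  have h : α < β := (mem_Ioc.mp hβ).1
  rw [← prod_prod_gammaMinus _ _ _ h]
  exact HasValueAt.prod _ fun i _ => HasValueAt.prod _ fun j _ => hasValueAt_gammaMinus _ _ h

end
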